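/- arXiv:2207.04469 — 5 statements merged into one kernel-verified Lean document; each statement's English description precedes it below -/
import Mathlib

section
/- For every n ≥ 1, the following identity holds in F, where every complete homogeneous symmetric polynomial h_m below is evaluated at the 2n quantities (u X_1, …, u X_n, v X_1^{−1}, …, v X_n^{−1}): det_{1 ≤ i, j ≤ n}( (u²X_i² + u w X_i)^j + (v²X_i^{−2} + v w X_i^{−1})^j ) / ∏_{1 ≤ i < j ≤ n} (X_j − X_i)(u − v X_i^{−1} X_j^{−1}) = det_{1 ≤ i, j ≤ n}( Σ_{k=j}^{2j} binom(j, k−j) w^{2j−k} ( h_{k−i+1} − u^{n−i+1} v^{n−i+1} h_{k+i−2n−1} ) ). -/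
noncomputable section

/-- Complete homogeneous symmetric polynomial of degree `m` evaluated at the list `l`. -/
def hpow {R : Type*} [CommSemiring R] : ℕ → List R → R
  | 0, _ => 1
  | _ + 1, [] => 0
  | m + 1, x :: xs => hpow (m + 1) xs + x * hpow m (x :: xs)
  termination_by m l => m + l.length

/-- `h_m` with integer degree: zero for negative degrees. -/
def hz {R : Type*} [CommSemiring R] (m : ℤ) (l : List R) : R :=
  if m < 0 then 0 else hpow m.toNat l

/-- Elementary symmetric polynomial of degree `m` evaluated at the list `l`;
zero for `m` larger than the length of `l`. -/
def epow {R : Type*} [CommSemiring R] : ℕ → List R → R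
  | 0, _ => 1
  | _ + 1, [] => 0
  | m + 1, x :: xs => epow (m + 1) xs + x * epow m xs

/-- `e_m` with integer degree: zero for negative degrees. -/
def ez {R : Type*} [CommSemiring R] (m : ℤ) (l : List R) : R :=
  if m < 0 then 0 else epow m.toNat l

/-- The field `F = ℚ(u, v, w, X_1, …, X_n)` of rational functions. -/
abbrev Fld (n : ℕ) : Type := FractionRing (MvPolynomial (Fin n ⊕ Fin 3) ℚ)

/-- The indeterminate `u`. -/
def uu (n : ℕ) : Fld n :=
  algebraMap (MvPolynomial (Fin n ⊕ Fin 3) ℚ) (Fld n) (MvPolynomial.X (Sum.inr 0))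

/-- The indeterminate `v`. -/
def vv (n : ℕ) : Fld n :=
  algebraMap (MvPolynomial (Fin n ⊕ Fin 3) ℚ) (Fld n) (MvPolynomial.X (Sum.inr 1))

/-- The indeterminate `w`. -/
def wP (n : ℕ) : Fld n :=
  algebraMap (MvPolynomial (Fin n ⊕ Fin 3) ℚ) (Fld n) (MvPolynomial.X (Sum.inr 2))

/-- The indeterminate `X_i` (here `i : Fin n` corresponds to `X_{i+1}`). -/
def XP {n : ℕ} (i : Fin n) : Fld n :=
  algebraMap (MvPolynomial (Fin n ⊕ Fin 3) ℚ) (Fld n) (MvPolynomial.X (Sum.inl i))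

/-- The `2n` quantities `(u X_1, …, u X_n, v X_1^{−1}, …, v X_n^{−1})`. -/
def bigArgs (n : ℕ) : List (Fld n) :=
  ((List.finRange n).map fun i => uu n * XP i) ++ ((List.finRange n).map fun i => vv n * (XP i)⁻¹)

/-- `h_m(u X_1, …, u X_n, v X_1^{−1}, …, v X_n^{−1})`. -/
def Hn (n : ℕ) (m : ℤ) : Fld n := hz m (bigArgs n)

open Finset

section Series

variable {R : Type*} [CommRing R]

lemma hpow_nil_succ (m : ℕ) : hpow (m + 1) ([] : List R) = 0 := by
  rw [hpow]

lemma hpow_cons_succ (m : ℕ) (a : R) (l : List R) :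
    hpow (m + 1) (a :: l) = hpow (m + 1) l + a * hpow m (a :: l) := by
  rw [hpow]

lemma hpow_zero (l : List R) : hpow 0 l = 1 := by
  cases l <;> rw [hpow]

/-- The generating series of the complete homogeneous symmetric polynomials. -/
lemma mk_hpow_mul_prod (l : List R) :
    (PowerSeries.mk fun m => hpow m l) *
      (l.map fun a => 1 - PowerSeries.C a * PowerSeries.X).prod = 1 := by
  induction l with
  | nil =>
    ext m
    cases m <;> simp [hpow_nil_succ, hpow_zero, PowerSeries.coeff_one]
  | cons a l ih =>
    rw [List.map_cons, List.prod_cons, ← mul_assoc]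
    convert ih using 2
    ext m
    cases m with
    | zero => simp [hpow_zero]
    | succ m =>
      rw [mul_sub, mul_one, mul_left_comm, map_sub, PowerSeries.coeff_C_mul,
        PowerSeries.coeff_succ_mul_X, PowerSeries.coeff_mk, PowerSeries.coeff_mk,
        PowerSeries.coeff_mk, hpow_cons_succ]
      ring

lemma mk_pow_mul (a : R) :
    (PowerSeries.mk fun m => a ^ m) * (1 - PowerSeries.C a * PowerSeries.X) = 1 := by
  ext m
  cases m with
  | zero => simp
  | succ m =>
    rw [mul_sub, mul_one, mul_left_comm, map_sub, PowerSeries.coeff_C_mul,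
      PowerSeries.coeff_succ_mul_X, PowerSeries.coeff_mk, PowerSeries.coeff_mk,
      PowerSeries.coeff_one]
    simp [pow_succ']

/-- The monic polynomials in `t` that are the coefficients of `1 / (1 - t z + c z ^ 2)`. -/
def chebyshevLike (c : R) : ℕ → Polynomial R
  | 0 => 1
  | 1 => Polynomial.X
  | m + 2 => Polynomial.X * chebyshevLike c (m + 1) - Polynomial.C c * chebyshevLike c m

lemma chebyshevLike_monic [Nontrivial R] (c : R) (m : ℕ) :
    (chebyshevLike c m).natDegree = m ∧ (chebyshevLike c m).Monic := by
  induction m using Nat.twoStepInduction with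
  | zero => simp [chebyshevLike]
  | one => simp [chebyshevLike, Polynomial.monic_X]
  | more m ih₁ ih₂ =>
    have hX : (Polynomial.X * chebyshevLike c (m + 1)).natDegree = m + 2 := by
      rw [Polynomial.monic_X.natDegree_mul ih₂.2, ih₂.1, Polynomial.natDegree_X]
      ring
    have hlt : (Polynomial.C c * chebyshevLike c m).natDegree <
        (Polynomial.X * chebyshevLike c (m + 1)).natDegree := by
      have := Polynomial.natDegree_C_mul_le c (chebyshevLike c m)
      omega
    rw [chebyshevLike]
    refine ⟨by rw [Polynomial.natDegree_sub_eq_left_of_natDegree_lt hlt, hX], ?_⟩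
    exact (Polynomial.monic_X.mul ih₂.2).sub_of_left
      (Polynomial.degree_lt_degree hlt)

/-- The polynomial `1 - t z + c z ^ 2`. -/
def quadFactor (c t : R) : Polynomial R :=
  1 - Polynomial.C t * Polynomial.X + Polynomial.C c * Polynomial.X ^ 2

lemma mk_chebyshevLike_mul (c t : R) :
    (PowerSeries.mk fun m => (chebyshevLike c m).eval t) * (quadFactor c t : PowerSeries R) =
      1 := by
  have h : (quadFactor c t : PowerSeries R) =
      1 - PowerSeries.C t * PowerSeries.X + PowerSeries.C c * (PowerSeries.X ^ 2) := by
    simp [quadFactor]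
  rw [h, mul_add, mul_sub, mul_one, mul_left_comm, mul_left_comm _ (PowerSeries.C c), pow_two,
    ← mul_assoc _ PowerSeries.X PowerSeries.X]
  ext m
  rw [map_add, map_sub, PowerSeries.coeff_C_mul, PowerSeries.coeff_C_mul]
  rcases m with _ | _ | m
  · simp [chebyshevLike]
  · rw [PowerSeries.coeff_succ_mul_X, PowerSeries.coeff_succ_mul_X, PowerSeries.coeff_one]
    simp [chebyshevLike]
  · simp only [PowerSeries.coeff_succ_mul_X, PowerSeries.coeff_one, PowerSeries.coeff_mk]
    simp [chebyshevLike]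

end Series

section Palindrome

variable {R : Type*} [CommRing R]

lemma reflect_quadFactor (c t : R) :
    (Polynomial.reflect 2 (quadFactor c t)).comp (Polynomial.C c * Polynomial.X) =
      Polynomial.C c * quadFactor c t := by
  have h : Polynomial.reflect 2 (quadFactor c t) =
      Polynomial.X ^ 2 - Polynomial.C t * Polynomial.X + Polynomial.C c := by
    rw [quadFactor, Polynomial.reflect_add, Polynomial.reflect_sub]
    rw [← Polynomial.C_1, Polynomial.reflect_C, Polynomial.reflect_C_mul_X_pow]
    have ht : Polynomial.reflect 2 (Polynomial.C t * Polynomial.X) =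
        Polynomial.C t * Polynomial.X := by
      have := Polynomial.reflect_C_mul_X_pow (R := R) 2 1 (c := t)
      rwa [pow_one, Polynomial.revAt_le (by norm_num), pow_one] at this
    rw [ht, Polynomial.revAt_le le_rfl]
    simp
  rw [h, quadFactor]
  simp
  ring

lemma natDegree_quadFactor_le (c t : R) : (quadFactor c t).natDegree ≤ 2 := by
  rw [quadFactor]
  compute_degree

lemma reflect_prod_quadFactor {ι : Type*} (c : R) (t : ι → R) (s : Finset ι) :
    (∏ j ∈ s, quadFactor c (t j)).natDegree ≤ 2 * #s ∧
      (Polynomial.reflect (2 * #s) (∏ j ∈ s, quadFactor c (t j))).comp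
          (Polynomial.C c * Polynomial.X) =
        Polynomial.C (c ^ #s) * ∏ j ∈ s, quadFactor c (t j) := by
  classical
  induction s using Finset.induction_on with
  | empty =>
    have := Polynomial.reflect_C (1 : R) 0
    rw [Polynomial.C_1] at this
    simp [this]
  | insert a s ha ih =>
    have hd := natDegree_quadFactor_le c (t a)
    have e : 2 * (#s + 1) = 2 + 2 * #s := by ring
    rw [Finset.prod_insert ha, Finset.card_insert_of_notMem ha, e]
    refine ⟨Polynomial.natDegree_mul_le.trans (add_le_add hd ih.1), ?_⟩
    rw [Polynomial.reflect_mul _ _ hd ih.1, Polynomial.mul_comp, ih.2, reflect_quadFactor,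
      pow_succ, Polynomial.C_mul]
    ring

/-- The polynomial `(1 - c z ^ 2) ∏ (1 - t_j z + c z ^ 2)`. -/
def antiPal {ι : Type*} (c : R) (t : ι → R) (s : Finset ι) : Polynomial R :=
  (1 - Polynomial.C c * Polynomial.X ^ 2) * ∏ j ∈ s, quadFactor c (t j)

lemma natDegree_antiPal_le {ι : Type*} (c : R) (t : ι → R) (s : Finset ι) :
    (antiPal c t s).natDegree ≤ 2 + 2 * #s := by
  refine Polynomial.natDegree_mul_le.trans
    (add_le_add ?_ (reflect_prod_quadFactor c t s).1)
  compute_degree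

lemma reflect_antiPal {ι : Type*} (c : R) (t : ι → R) (s : Finset ι) :
    (Polynomial.reflect (2 + 2 * #s) (antiPal c t s)).comp (Polynomial.C c * Polynomial.X) =
      -(Polynomial.C (c ^ (#s + 1)) * antiPal c t s) := by
  have hd : (1 - Polynomial.C c * Polynomial.X ^ 2 : Polynomial R).natDegree ≤ 2 := by
    compute_degree
  have h : Polynomial.reflect 2 (1 - Polynomial.C c * Polynomial.X ^ 2 : Polynomial R) =
      Polynomial.X ^ 2 - Polynomial.C c := by
    rw [Polynomial.reflect_sub, ← Polynomial.C_1, Polynomial.reflect_C,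
      Polynomial.reflect_C_mul_X_pow, Polynomial.revAt_le le_rfl]
    simp
  rw [antiPal, Polynomial.reflect_mul _ _ hd (reflect_prod_quadFactor c t s).1,
    Polynomial.mul_comp, (reflect_prod_quadFactor c t s).2, h,
    pow_succ c, Polynomial.C_mul]
  simp
  ring

lemma antiPal_coeff [IsDomain R] {ι : Type*} {c : R} (hc : c ≠ 0) (t : ι → R) (s : Finset ι)
    {m : ℕ} (hm : m ≤ #s + 1) :
    (antiPal c t s).coeff (2 * (#s + 1) - m) = -(c ^ (#s + 1 - m) * (antiPal c t s).coeff m) := by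
  have h := congrArg (fun p => Polynomial.coeff p m) (reflect_antiPal c t s)
  simp only [Polynomial.comp_C_mul_X_coeff, Polynomial.coeff_neg, Polynomial.coeff_C_mul,
    Polynomial.coeff_reflect] at h
  rw [Polynomial.revAt_le (by omega)] at h
  have e : c ^ (#s + 1) = c ^ m * c ^ (#s + 1 - m) := by
    rw [← pow_add]
    congr 1
    omega
  rw [e] at h
  apply mul_left_cancel₀ (pow_ne_zero m hc)
  rw [show 2 * (#s + 1) - m = 2 + 2 * #s - m by omega]
  linear_combination h

end Palindrome

lemma hz_neg {R : Type*} [CommSemiring R] {m : ℤ} (l : List R) (hm : m < 0) : hz m l = 0 := by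
  rw [hz, if_pos hm]

lemma coeff_mul_mk_hpow {R : Type*} [CommRing R] (Q : Polynomial R) (l : List R) {N : ℕ}
    (hN : Q.natDegree < N) (k : ℕ) :
    PowerSeries.coeff k ((Q : PowerSeries R) * PowerSeries.mk fun m => hpow m l) =
      ∑ a ∈ range N, Q.coeff a * hz ((k : ℤ) - a) l := by
  have hz_nat : ∀ a ≤ k, hz ((k : ℤ) - a) l = hpow (k - a) l := by
    intro a ha
    rw [hz, if_neg (by omega)]
    congr 1
    omega
  rw [PowerSeries.coeff_mul, Finset.Nat.sum_antidiagonal_eq_sum_range_succ_mk]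
  trans ∑ a ∈ range (N + k + 1), Q.coeff a * hz ((k : ℤ) - a) l
  · trans ∑ a ∈ range k.succ, Q.coeff a * hz ((k : ℤ) - a) l
    · refine Finset.sum_congr rfl fun a ha => ?_
      rw [hz_nat a (by simpa [Nat.lt_succ_iff] using ha)]
      simp
    apply Finset.sum_subset
    · intro a ha
      simp only [mem_range] at ha ⊢
      omega
    · intro a _ ha
      simp only [mem_range] at ha
      rw [hz_neg _ (by omega), mul_zero]
  · symm
    apply Finset.sum_subset
    · intro a ha
      simp only [mem_range] at ha ⊢
      omega
    · intro a _ ha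
      simp only [mem_range] at ha
      rw [Polynomial.coeff_eq_zero_of_natDegree_lt (by omega), zero_mul]

/-- Folding a sum of `2 n + 1` terms with antipalindromic weights onto its first half. -/
lemma sum_range_antipalindromic {R : Type*} [CommRing R] (n : ℕ) (q : ℕ → R) (b c : ℕ → R)
    (hmid : q n = 0) (hq : ∀ m < n, q (2 * n - m) = -(c m * q m)) :
    ∑ a ∈ range (2 * n + 1), q a * b a =
      ∑ m ∈ range n, q m * (b m - c m * b (2 * n - m)) := by
  rw [show 2 * n + 1 = n + (n + 1) by ring, Finset.sum_range_add, Finset.sum_range_succ',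
    ← Finset.sum_range_reflect (fun k => q (n + (k + 1)) * b (n + (k + 1))), add_zero, hmid,
    zero_mul, add_zero, ← Finset.sum_add_distrib]
  refine Finset.sum_congr rfl fun m hm => ?_
  rw [mem_range] at hm
  rw [show n + (n - 1 - m + 1) = 2 * n - m by omega, hq m hm]
  ring

/-- The power sums `x_i ^ k + y_i ^ k` in terms of complete homogeneous symmetric polynomials. -/
lemma pow_add_pow_eq_sum {K : Type*} [Field K] [CharZero K] {n : ℕ} (x y : Fin n → K) {c : K}
    (hc : c ≠ 0) (hxy : ∀ i, x i * y i = c) (l : List K)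
    (hl : (l.map fun a => 1 - PowerSeries.C a * PowerSeries.X).prod =
      ∏ i, ((1 - PowerSeries.C (x i) * PowerSeries.X) *
        (1 - PowerSeries.C (y i) * PowerSeries.X)))
    (i : Fin n) {k : ℕ} (hk : k ≠ 0) :
    x i ^ k + y i ^ k = ∑ m : Fin n,
      (antiPal c (fun j => x j + y j) (univ.erase i)).coeff m *
        (hz ((k : ℤ) - (m : ℕ)) l - c ^ (n - (m : ℕ)) * hz ((k : ℤ) + (m : ℕ) - 2 * n) l) := by
  have hcard : #((univ : Finset (Fin n)).erase i) + 1 = n := by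
    rw [Finset.card_erase_add_one (mem_univ i), Finset.card_univ, Fintype.card_fin]
  set Q := antiPal c (fun j => x j + y j) (univ.erase i) with hQ
  have hdeg : Q.natDegree < 2 * n + 1 := by
    have := natDegree_antiPal_le c (fun j => x j + y j) (univ.erase i)
    rw [← hQ] at this
    omega
  have hanti : ∀ m ≤ n, Q.coeff (2 * n - m) = -(c ^ (n - m) * Q.coeff m) := by
    intro m hm
    have := antiPal_coeff hc (fun j => x j + y j) (univ.erase i) (m := m) (by omega)
    rwa [hcard] at this
  have hmid : Q.coeff n = 0 := by
    have := hanti n le_rfl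
    rw [show 2 * n - n = n by omega, Nat.sub_self, pow_zero, one_mul] at this
    exact self_eq_neg.mp this
  have hquad : ∀ j, (quadFactor c (x j + y j) : PowerSeries K) =
      (1 - PowerSeries.C (x j) * PowerSeries.X) * (1 - PowerSeries.C (y j) * PowerSeries.X) := by
    intro j
    simp only [quadFactor, ← hxy j, Polynomial.coe_add, Polynomial.coe_sub, Polynomial.coe_one,
      Polynomial.coe_mul, Polynomial.coe_C, Polynomial.coe_X, Polynomial.coe_pow, map_add, map_mul]
    ring
  have hser : (PowerSeries.mk fun m => x i ^ m) + (PowerSeries.mk fun m => y i ^ m) =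
      1 + (Q : PowerSeries K) * PowerSeries.mk fun m => hpow m l := by
    have hH := mk_hpow_mul_prod l
    rw [hl, ← Finset.mul_prod_erase _ _ (mem_univ i)] at hH
    have hA := mk_pow_mul (x i)
    have hB := mk_pow_mul (y i)
    have hQ' : (Q : PowerSeries K) = (1 - PowerSeries.C (x i) * PowerSeries.C (y i) *
        PowerSeries.X ^ 2) * ∏ j ∈ univ.erase i,
          ((1 - PowerSeries.C (x j) * PowerSeries.X) *
            (1 - PowerSeries.C (y j) * PowerSeries.X)) := by
      rw [hQ, antiPal, Polynomial.coe_mul, ← Finset.prod_congr rfl (fun j _ => hquad j),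
        ← map_mul, hxy i, ← Polynomial.coeToPowerSeries.ringHom_apply
          (φ := ∏ j ∈ _, _), map_prod]
      simp
    rw [hQ']
    set A := PowerSeries.mk fun m => x i ^ m
    set B := PowerSeries.mk fun m => y i ^ m
    set H := PowerSeries.mk fun m => hpow m l
    set P := ∏ j ∈ univ.erase i, ((1 - PowerSeries.C (x j) * PowerSeries.X) *
            (1 - PowerSeries.C (y j) * PowerSeries.X))
    set a := PowerSeries.C (x i) * PowerSeries.X with ha
    set b := PowerSeries.C (y i) * PowerSeries.X with hb
    have hPH : P * H = A * B := by
      linear_combination A * B * hH - P * H * (B * (1 - b) * hA + hB)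
    have hab : PowerSeries.C (x i) * PowerSeries.C (y i) * PowerSeries.X ^ 2 = a * b := by
      rw [ha, hb]; ring
    rw [hab, mul_assoc, hPH]
    linear_combination (-B + B * (1 - b)) * hA + (1 - A) * hB
  have hcoeff := congrArg (PowerSeries.coeff k) hser
  rw [map_add, map_add, PowerSeries.coeff_mk, PowerSeries.coeff_mk, PowerSeries.coeff_one,
    if_neg hk, zero_add, coeff_mul_mk_hpow Q l hdeg,
    sum_range_antipalindromic n Q.coeff (fun a => hz ((k : ℤ) - a) l) (fun m => c ^ (n - m)) hmid
      fun m hm => hanti m hm.le] at hcoeff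
  rw [hcoeff, Finset.sum_range]
  refine Finset.sum_congr rfl fun m _ => ?_
  rw [Nat.cast_sub (by omega)]
  congr 4
  push_cast
  ring

lemma det_antiPal_coeff {K : Type*} [Field K] {n : ℕ} (c : K) (t : Fin n → K) :
    (Matrix.of fun i m : Fin n => (antiPal c t (univ.erase i)).coeff m).det =
      (Matrix.vandermonde t).det := by
  set G := antiPal c t univ with hG
  have hfac : (Matrix.of fun i m : Fin n => (antiPal c t (univ.erase i)).coeff m) =
      (Matrix.of fun i l : Fin n => (chebyshevLike c l).eval (t i)) *
        Matrix.of fun l m : Fin n => if l ≤ m then G.coeff (m - l) else 0 := by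
    ext i m
    have hser : (antiPal c t (univ.erase i) : PowerSeries K) =
        (PowerSeries.mk fun m => (chebyshevLike c m).eval (t i)) * (G : PowerSeries K) := by
      have hS := mk_chebyshevLike_mul c (t i)
      rw [hG, antiPal, antiPal, ← Finset.mul_prod_erase _ _ (mem_univ i)]
      simp only [Polynomial.coe_mul]
      linear_combination -(((1 - Polynomial.C c * Polynomial.X ^ 2 : Polynomial K) :
        PowerSeries K) * ((∏ j ∈ univ.erase i, quadFactor c (t j) : Polynomial K) :
          PowerSeries K)) * hS
    have hco := congrArg (PowerSeries.coeff (m : ℕ)) hser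
    rw [Polynomial.coeff_coe, PowerSeries.coeff_mul,
      Finset.Nat.sum_antidiagonal_eq_sum_range_succ_mk] at hco
    rw [Matrix.of_apply, hco, Matrix.mul_apply]
    simp only [Matrix.of_apply, mul_ite, mul_zero, PowerSeries.coeff_mk, Polynomial.coeff_coe]
    simp only [Fin.le_def]
    rw [Fin.sum_univ_eq_sum_range (fun l : ℕ => if l ≤ (m : ℕ) then
      (chebyshevLike c l).eval (t i) * G.coeff (m - l) else 0), ← Finset.sum_filter]
    refine Finset.sum_congr ?_ fun _ _ => rfl
    ext l
    simp only [mem_range, mem_filter]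
    omega
  have htri : (Matrix.of fun l m : Fin n => if l ≤ m then G.coeff (m - l) else 0).det = 1 := by
    rw [Matrix.det_of_isUpperTriangular]
    · refine Finset.prod_eq_one fun l _ => ?_
      have : ∀ s : Finset (Fin n), (∏ j ∈ s, quadFactor c (t j)).coeff 0 = 1 := fun s => by
        rw [Polynomial.coeff_zero_eq_eval_zero, Polynomial.eval_prod]
        simp [quadFactor]
      simp [hG, antiPal, Polynomial.mul_coeff_zero, this]
    · intro l m hlm
      exact if_neg (not_le.mpr hlm)
  rw [hfac, Matrix.det_mul, htri, mul_one]
  exact (Matrix.det_eval_matrixOfPolynomials_eq_det_vandermonde t _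
    (fun l => (chebyshevLike_monic c l).1) fun l => (chebyshevLike_monic c l).2).symm

lemma sq_add_mul_pow {R : Type*} [CommRing R] (x w : R) (J : ℕ) :
    (x ^ 2 + w * x) ^ J =
      ∑ k ∈ Icc J (2 * J), (Nat.choose J (k - J) : R) * w ^ (2 * J - k) * x ^ k := by
  rw [add_pow, ← Finset.Ico_add_one_right_eq_Icc, Finset.sum_Ico_eq_sum_range,
    show 2 * J + 1 - J = J + 1 by omega]
  refine Finset.sum_congr rfl fun m hm => ?_
  rw [mem_range] at hm
  rw [Nat.add_sub_cancel_left, show 2 * J - (J + m) = J - m by omega, mul_pow, ← pow_mul,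
    show J + m = 2 * m + (J - m) by omega, pow_add]
  ring

lemma algebraMap_X_ne_zero {n : ℕ} (s : Fin n ⊕ Fin 3) :
    algebraMap (MvPolynomial (Fin n ⊕ Fin 3) ℚ) (Fld n) (MvPolynomial.X s) ≠ 0 := by
  simp [MvPolynomial.X_ne_zero]

lemma prod_bigArgs (n : ℕ) :
    ((bigArgs n).map fun a => 1 - PowerSeries.C a * PowerSeries.X).prod =
      ∏ i, ((1 - PowerSeries.C (uu n * XP i) * PowerSeries.X) *
        (1 - PowerSeries.C (vv n * (XP i)⁻¹) * PowerSeries.X)) := by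
  rw [bigArgs, List.map_append, List.prod_append, List.map_map, List.map_map,
    Finset.prod_mul_distrib, ← List.prod_ofFn, ← List.prod_ofFn, List.ofFn_eq_map,
    List.ofFn_eq_map]
  rfl

lemma uu_mul_XP_add_injective (n : ℕ) :
    Function.Injective fun i : Fin n => uu n * XP i + vv n * (XP i)⁻¹ := by
  intro i j hij
  by_contra hne
  have hi : XP i ≠ 0 := algebraMap_X_ne_zero _
  have hj : XP j ≠ 0 := algebraMap_X_ne_zero _
  simp only at hij
  field_simp at hij
  have hpoly : ((MvPolynomial.X (Sum.inr 0) * MvPolynomial.X (Sum.inl i) ^ 2 +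
      MvPolynomial.X (Sum.inr 1)) * MvPolynomial.X (Sum.inl j) :
        MvPolynomial (Fin n ⊕ Fin 3) ℚ) = MvPolynomial.X (Sum.inl i) *
      (MvPolynomial.X (Sum.inr 0) * MvPolynomial.X (Sum.inl j) ^ 2 +
        MvPolynomial.X (Sum.inr 1)) := by
    apply IsFractionRing.injective (MvPolynomial (Fin n ⊕ Fin 3) ℚ) (Fld n)
    simp only [map_mul, map_add, map_pow]
    unfold uu vv XP at hij
    linear_combination hij
  have h := congrArg (MvPolynomial.eval
    (Sum.elim (fun k => if k = i then 1 else 2) fun _ => 1 : Fin n ⊕ Fin 3 → ℚ)) hpoly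
  simp [Ne.symm hne] at h
  norm_num at h

/-- **Corollary 5.2 (2).** For `n ≥ 1`, in `ℚ(u,v,w,X_1,…,X_n)`, with all `h`'s evaluated at
`(u X_1, …, u X_n, v X_1^{−1}, …, v X_n^{−1})`:
`det_{1≤i,j≤n}((u²X_i² + uwX_i)^j + (v²X_i^{−2} + vwX_i^{−1})^j)
  / ∏_{1≤i<j≤n}(X_j − X_i)(u − vX_i^{−1}X_j^{−1})
 = det_{1≤i,j≤n}(Σ_{k=j}^{2j} binom(j,k−j) w^{2j−k}
     (h_{k−i+1} − u^{n−i+1}v^{n−i+1} h_{k+i−2n−1}))`. -/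
theorem det_add_quotient_eq_jacobiTrudi (n : ℕ) (hn : 1 ≤ n) :
    (Matrix.of fun i j : Fin n =>
          ((uu n) ^ 2 * (XP i) ^ 2 + uu n * wP n * XP i) ^ ((j : ℕ) + 1) +
            ((vv n) ^ 2 * ((XP i)⁻¹) ^ 2 + vv n * wP n * (XP i)⁻¹) ^ ((j : ℕ) + 1)).det /
      (∏ p ∈ Finset.univ.filter (fun p : Fin n × Fin n => p.1 < p.2),
          ((XP p.2 - XP p.1) * (uu n - vv n * (XP p.1)⁻¹ * (XP p.2)⁻¹))) =
      (Matrix.of fun i j : Fin n =>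
        ∑ k ∈ Finset.Icc ((j : ℕ) + 1) (2 * ((j : ℕ) + 1)),
          (Nat.choose ((j : ℕ) + 1) (k - ((j : ℕ) + 1)) : Fld n) *
            wP n ^ (2 * ((j : ℕ) + 1) - k) *
            (Hn n ((k : ℤ) - ((i : ℕ) + 1) + 1) -
              uu n ^ (n - ((i : ℕ) + 1) + 1) * vv n ^ (n - ((i : ℕ) + 1) + 1) *
                Hn n ((k : ℤ) + ((i : ℕ) + 1) - 2 * (n : ℤ) - 1))).det := by
  have hu : uu n ≠ 0 := algebraMap_X_ne_zero _
  have hv : vv n ≠ 0 := algebraMap_X_ne_zero _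
  have hX : ∀ i : Fin n, XP i ≠ 0 := fun i => algebraMap_X_ne_zero _
  set t : Fin n → Fld n := fun i => uu n * XP i + vv n * (XP i)⁻¹ with ht
  have hden : (∏ p ∈ Finset.univ.filter (fun p : Fin n × Fin n => p.1 < p.2),
      ((XP p.2 - XP p.1) * (uu n - vv n * (XP p.1)⁻¹ * (XP p.2)⁻¹))) =
      (Matrix.vandermonde t).det := by
    rw [Matrix.det_vandermonde, Finset.prod_sigma']
    refine Finset.prod_bij' (fun p _ => ⟨p.1, p.2⟩) (fun p _ => (p.1, p.2)) ?_ ?_ ?_ ?_ ?_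
    · simp
    · simp
    · simp
    · simp
    · intro p _
      have h₁ := hX p.1
      have h₂ := hX p.2
      simp only [ht]
      field_simp
      ring
  have hdet : (Matrix.vandermonde t).det ≠ 0 :=
    Matrix.det_vandermonde_ne_zero_iff.mpr (uu_mul_XP_add_injective n)
  rw [hden, div_eq_iff hdet, mul_comm _ (Matrix.vandermonde t).det,
    ← det_antiPal_coeff (uu n * vv n) t, ← Matrix.det_mul]
  congr 1
  ext i j
  have hxy : ∀ i : Fin n, uu n * XP i * (vv n * (XP i)⁻¹) = uu n * vv n := fun i => by
    have := hX i
    field_simp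
  rw [Matrix.of_apply, Matrix.mul_apply,
    show (uu n) ^ 2 * (XP i) ^ 2 + uu n * wP n * XP i =
      (uu n * XP i) ^ 2 + wP n * (uu n * XP i) by ring,
    show (vv n) ^ 2 * ((XP i)⁻¹) ^ 2 + vv n * wP n * (XP i)⁻¹ =
      (vv n * (XP i)⁻¹) ^ 2 + wP n * (vv n * (XP i)⁻¹) by ring,
    sq_add_mul_pow, sq_add_mul_pow, ← Finset.sum_add_distrib]
  simp only [Matrix.of_apply, Finset.mul_sum]
  rw [Finset.sum_comm]
  refine Finset.sum_congr rfl fun k hk => ?_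
  rw [Finset.mem_Icc] at hk
  rw [← mul_add, pow_add_pow_eq_sum (fun i => uu n * XP i) (fun i => vv n * (XP i)⁻¹)
    (mul_ne_zero hu hv) hxy (bigArgs n) (prod_bigArgs n) i (by omega), Finset.mul_sum]
  refine Finset.sum_congr rfl fun m _ => ?_
  have e₁ : n - ((m : ℕ) + 1) + 1 = n - m := by omega
  have e₂ : (k : ℤ) - ((m : ℕ) + 1) + 1 = k - (m : ℕ) := by ring
  have e₃ : (k : ℤ) + ((m : ℕ) + 1) - 2 * n - 1 = k + (m : ℕ) - 2 * n := by ring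
  rw [e₁, e₂, e₃, Hn, Hn, mul_pow]
  ring


end
end

section
/- Let n ≥ 1 and let m be an integer with 0 ≤ m ≤ n − 1. Then the following identity holds in F: Σ_{l=1}^{n} (−u X_l − v X_l^{−1})^m / ∏_{j ≠ l} (X_j − X_l)(u − v X_l^{−1} X_j^{−1}) = 1 if m = n − 1, and = 0 if m < n − 1. (The product in each denominator runs over all j ∈ {1, …, n} with j ≠ l, and each denominator is a nonzero element of F.) -/
noncomputable section

open Polynomial in
/-- The sum of `y i ^ m / ∏_{j ≠ i} (y i - y j)` over `n` distinct nodes is the coefficient of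
`X ^ (n - 1)` in `X ^ m`, for `m < n`. -/
theorem sum_pow_div_prod_sub {K ι : Type*} [Field K] [DecidableEq ι] (s : Finset ι) (y : ι → K)
    (hy : Set.InjOn y s) (m : ℕ) (hm : m < s.card) :
    ∑ i ∈ s, y i ^ m / ∏ j ∈ s.erase i, (y i - y j) = if m = s.card - 1 then 1 else 0 := by
  have h := Lagrange.coeff_eq_sum (P := (X : K[X]) ^ m) hy
    (by rw [degree_X_pow]; exact_mod_cast hm)
  simp only [eval_pow, eval_X, coeff_X_pow] at h
  rw [← h]
  simp only [eq_comm]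

theorem XP_injective (n : ℕ) : Function.Injective (XP (n := n)) := fun i j h => by
  simpa using MvPolynomial.X_injective (IsFractionRing.injective _ (Fld n) h)

theorem XP_ne_zero {n : ℕ} (i : Fin n) : XP i ≠ 0 := by
  simp [XP]

theorem uu_mul_XP_mul_XP_ne_vv {n : ℕ} (i j : Fin n) : uu n * XP i * XP j ≠ vv n := by
  simp only [uu, vv, XP, ← map_mul]
  intro h
  have h' := congrArg (MvPolynomial.eval (Sum.elim (fun _ => 0) ![0, 1, 0]))
    (IsFractionRing.injective _ (Fld n) h)
  simp at h'

/-- Factorisation of the difference of two values of `x ↦ -u x - v / x`. -/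
theorem neg_mul_sub_mul_inv_sub {K : Type*} [Field K] {u v a b : K} (ha : a ≠ 0) (hb : b ≠ 0) :
    (-(u * a) - v * a⁻¹) - (-(u * b) - v * b⁻¹) = (b - a) * (u - v * a⁻¹ * b⁻¹) := by
  field_simp
  ring

theorem neg_uu_mul_XP_sub_injective (n : ℕ) :
    Function.Injective fun i : Fin n => -(uu n * XP i) - vv n * (XP i)⁻¹ := by
  intro i j h
  have hi := XP_ne_zero i
  have hj := XP_ne_zero j
  have h' := sub_eq_zero.mpr h
  rw [neg_mul_sub_mul_inv_sub hi hj, mul_eq_zero] at h'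
  rcases h' with h' | h'
  · exact (XP_injective n (sub_eq_zero.mp h')).symm
  · refine absurd ?_ (uu_mul_XP_mul_XP_ne_vv i j)
    rw [sub_eq_zero.mp h']
    field_simp

/-- **Lemma 5.3.** For `n ≥ 1` and `0 ≤ m ≤ n − 1`, in `ℚ(u,v,w,X_1,…,X_n)`:
`Σ_{l=1}^n (−uX_l − vX_l^{−1})^m / ∏_{j ≠ l} (X_j − X_l)(u − vX_l^{−1}X_j^{−1})`
equals `1` if `m = n − 1` and `0` if `m < n − 1`. -/
theorem sum_pow_div_prod_eq_ite (n : ℕ) (hn : 1 ≤ n) (m : ℕ) (hm : m ≤ n - 1) :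
    (∑ l : Fin n,
        (-(uu n * XP l) - vv n * (XP l)⁻¹) ^ m /
          ∏ j ∈ Finset.univ.filter (fun j : Fin n => j ≠ l),
            ((XP j - XP l) * (uu n - vv n * (XP l)⁻¹ * (XP j)⁻¹))) =
      if m = n - 1 then 1 else 0 := by
  have h := sum_pow_div_prod_sub Finset.univ _ (neg_uu_mul_XP_sub_injective n).injOn m
    (by rw [Finset.card_fin]; omega)
  rw [Finset.card_fin] at h
  rw [← h]
  refine Finset.sum_congr rfl fun l _ => ?_
  rw [Finset.filter_ne']
  congr 1
  exact Finset.prod_congr rfl fun j _ =>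
    (neg_mul_sub_mul_inv_sub (XP_ne_zero l) (XP_ne_zero j)).symm

end
end

section
/- Let n ≥ 1, let m be an integer with m + n ≥ 0, and let 1 ≤ i ≤ n. Then the following identity holds in F: Σ_{l=−i+1}^{−1} (−1)^{i+l} · e_{i−1−l}(u X_{n−i+2}, v X_{n−i+2}^{−1}, …, u X_n, v X_n^{−1}) · h_{m+l}(u X_1, v X_1^{−1}, …, u X_n, v X_n^{−1}) + Σ_{l=1}^{i−1} (−1)^{i+l−1} · (u v)^l · e_{i−1−l}(u X_{n−i+2}, v X_{n−i+2}^{−1}, …, u X_n, v X_n^{−1}) · h_{m−l}(u X_1, v X_1^{−1}, …, u X_n, v X_n^{−1}) = 0, where the elementary symmetric polynomials e are evaluated at the 2(i−1) quantities u X_{n−i+2}, v X_{n−i+2}^{−1}, …, u X_n, v X_n^{−1}. -/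
noncomputable section

/-- The `2n` quantities `(u X_1, v X_1^{−1}, u X_2, v X_2^{−1}, …, u X_n, v X_n^{−1})`. -/
def interArgs (n : ℕ) : List (Fld n) :=
  (List.finRange n).flatMap fun d => [uu n * XP d, vv n * (XP d)⁻¹]

/-- The `2(i−1)` quantities `(u X_{n−i+2}, v X_{n−i+2}^{−1}, …, u X_n, v X_n^{−1})`. -/
def tailArgs (n i : ℕ) : List (Fld n) :=
  ((List.finRange n).drop (n - (i - 1))).flatMap fun d => [uu n * XP d, vv n * (XP d)⁻¹]

/-- The `2(n−i+1)` quantities `(u X_1, v X_1^{−1}, …, u X_{n−i+1}, v X_{n−i+1}^{−1})`. -/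
def headArgs (n i : ℕ) : List (Fld n) :=
  ((List.finRange n).take (n - i + 1)).flatMap fun d => [uu n * XP d, vv n * (XP d)⁻¹]

theorem ez_of_neg {R : Type*} [CommSemiring R] {m : ℤ} (hm : m < 0) (l : List R) :
    ez m l = 0 := if_pos hm

theorem ez_natCast {R : Type*} [CommSemiring R] (m : ℕ) (l : List R) :
    ez (m : ℤ) l = epow m l := by
  simp [ez]

theorem ez_cons {R : Type*} [CommSemiring R] (m : ℤ) (x : R) (xs : List R) :
    ez m (x :: xs) = ez m xs + x * ez (m - 1) xs := by
  rcases lt_or_ge m 0 with hm | hm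
  · simp [ez_of_neg hm, ez_of_neg (show m - 1 < 0 by omega)]
  · lift m to ℕ using hm
    cases m with
    | zero => simp [ez, epow]
    | succ m =>
      rw [show ((m + 1 : ℕ) : ℤ) - 1 = (m : ℤ) by push_cast; ring]
      simp only [ez_natCast, epow]

/-- Reciprocity for elementary symmetric polynomials of a list of pairs with constant product. -/
theorem ez_length_add_flatMap_pair {R α : Type*} [CommRing R] (f g : α → R) (q : R) (D : List α)
    (hq : ∀ d ∈ D, f d * g d = q) (j : ℕ) :
    ez ((D.length : ℤ) + j) (D.flatMap fun d => [f d, g d]) =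
      q ^ j * ez ((D.length : ℤ) - j) (D.flatMap fun d => [f d, g d]) := by
  induction D generalizing j with
  | nil =>
    cases j with
    | zero => simp
    | succ j =>
      rw [List.length_nil, Nat.cast_zero, zero_add, ez_natCast,
        ez_of_neg (show (0 : ℤ) - (j + 1 : ℕ) < 0 by omega)]
      simp [epow]
  | cons d D ih =>
    cases j with
    | zero => simp
    | succ j =>
      have hd : f d * g d = q := hq d (by simp)
      have ih := ih fun d hd => hq d (by simp [hd])
      have h₀ := ih j
      have h₁ := ih (j + 1)
      have h₂ := ih (j + 2)
      simp only [List.flatMap_cons, List.cons_append, List.nil_append, ez_cons, List.length_cons]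
      push_cast at h₀ h₁ h₂ ⊢
      generalize (D.flatMap fun d => [f d, g d]) = L at *
      generalize (D.length : ℤ) = k at *
      ring_nf at h₀ h₁ h₂ ⊢
      rw [h₀, h₁, h₂, ← hd]
      ring

theorem ez_tailArgs_add {n i : ℕ} (hi1 : 1 ≤ i) (hin : i ≤ n) (j : ℕ) :
    ez ((i : ℤ) - 1 + j) (tailArgs n i) =
      (uu n * vv n) ^ j * ez ((i : ℤ) - 1 - j) (tailArgs n i) := by
  have hX (d : Fin n) : (XP d : Fld n) ≠ 0 := by
    simp [XP, MvPolynomial.X_ne_zero]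
  have h := ez_length_add_flatMap_pair (fun d => uu n * XP d) (fun d => vv n * (XP d)⁻¹)
    (uu n * vv n) ((List.finRange n).drop (n - (i - 1)))
    (fun d _ => by field_simp [hX d]) j
  have hlen : (((List.finRange n).drop (n - (i - 1))).length : ℤ) = (i : ℤ) - 1 := by
    rw [List.length_drop, List.length_finRange]
    omega
  rwa [hlen] at h

/-- **Identity (6.2).** For `n ≥ 1`, an integer `m` with `m + n ≥ 0`, and `1 ≤ i ≤ n`, in
`ℚ(u,v,w,X_1,…,X_n)`:
`Σ_{l=−i+1}^{−1} (−1)^{i+l} e_{i−1−l}(uX_{n−i+2}, vX_{n−i+2}^{−1}, …, uX_n, vX_n^{−1})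
   h_{m+l}(uX_1, vX_1^{−1}, …, uX_n, vX_n^{−1})
 + Σ_{l=1}^{i−1} (−1)^{i+l−1} (uv)^l e_{i−1−l}(uX_{n−i+2}, vX_{n−i+2}^{−1}, …, uX_n, vX_n^{−1})
   h_{m−l}(uX_1, vX_1^{−1}, …, uX_n, vX_n^{−1}) = 0`. -/
theorem sum_e_mul_h_add_sum_e_mul_h_eq_zero (n : ℕ) (hn : 1 ≤ n) (m : ℤ) (hm : 0 ≤ m + n)
    (i : ℕ) (hi1 : 1 ≤ i) (hin : i ≤ n) :
    (∑ l ∈ Finset.Icc (-(i : ℤ) + 1) (-1 : ℤ),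
        (-1 : Fld n) ^ ((i : ℤ) + l) * ez ((i : ℤ) - 1 - l) (tailArgs n i) *
          hz (m + l) (interArgs n)) +
      (∑ l ∈ Finset.Icc (1 : ℤ) ((i : ℤ) - 1),
        (-1 : Fld n) ^ ((i : ℤ) + l - 1) * (uu n * vv n) ^ l *
          ez ((i : ℤ) - 1 - l) (tailArgs n i) * hz (m - l) (interArgs n)) = 0 := by
  have hreindex : ∀ f : ℤ → Fld n, ∑ l ∈ Finset.Icc (-(i : ℤ) + 1) (-1 : ℤ), f l =
      ∑ l ∈ Finset.Icc (1 : ℤ) ((i : ℤ) - 1), f (-l) := fun f =>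
    Finset.sum_nbij' (fun l => -l) (fun l => -l)
      (fun l hl => by simp only [Finset.mem_Icc] at hl ⊢; omega)
      (fun l hl => by simp only [Finset.mem_Icc] at hl ⊢; omega)
      (by simp) (by simp) (by simp)
  rw [hreindex, ← Finset.sum_add_distrib]
  refine Finset.sum_eq_zero fun l hl => ?_
  rw [Finset.mem_Icc] at hl
  lift l to ℕ using by omega
  have hsign : (-1 : Fld n) ^ ((i : ℤ) + -l) = -(-1 : Fld n) ^ ((i : ℤ) + l - 1) := by
    have hne : (-1 : Fld n) ≠ 0 := by simp
    rw [show (i : ℤ) + -l = (i + l - 1) + 1 + 2 * (-l) by ring, zpow_add₀ hne, zpow_mul,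
      zpow_add₀ hne]
    simp
  rw [hsign, sub_neg_eq_add, ez_tailArgs_add hi1 hin, zpow_natCast, ← sub_eq_add_neg]
  ring

end
end

section
/- Let N ≥ 1, let R be a commutative ring, let X_1, …, X_N ∈ R, let i be an integer with 1 ≤ i ≤ N, and let k be any integer. Then Σ_{l=1}^{N} h_{l−i}(X_l, X_{l+1}, …, X_N) · h_{k−l+1}(X_1, X_2, …, X_l) = h_{k−i+1}(X_1, X_2, …, X_N). -/
noncomputable section

theorem hpow_succ_append_singleton {R : Type*} [CommRing R] (x : R) (m : ℕ) (l : List R) :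
    hpow (m + 1) (l ++ [x]) = hpow (m + 1) l + x * hpow m (l ++ [x]) := by
  induction m generalizing l with
  | zero =>
    induction l with
    | nil => simp [hpow]
    | cons y ys ih =>
      simp only [List.cons_append, hpow] at ih ⊢
      rw [ih]
      ring
  | succ m ihm =>
    induction l with
    | nil => simp [hpow]
    | cons y ys ih =>
      have hcons (n : ℕ) (zs : List R) :
          hpow (n + 1) (y :: zs) = hpow (n + 1) zs + y * hpow n (y :: zs) := by
        rw [hpow]
      have h := ihm (y :: ys)
      rw [List.cons_append] at h ⊢
      linear_combination hcons (m + 1) (ys ++ [x]) - hcons (m + 1) ys -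
        x * hcons m (ys ++ [x]) + ih + y * h

theorem hz_append_singleton {R : Type*} [CommRing R] (x : R) (m : ℤ) (l : List R) :
    hz m (l ++ [x]) = hz m l + x * hz (m - 1) (l ++ [x]) := by
  rcases lt_trichotomy m 0 with hm | rfl | hm
  · simp [hz, hm, show m - 1 < 0 by omega]
  · simp [hz, hpow]
  · obtain ⟨n, rfl⟩ : ∃ n : ℕ, m = n + 1 := ⟨(m - 1).toNat, by omega⟩
    have h₁ : ¬ ((n : ℤ) + 1 < 0) := by omega
    have h₂ : ¬ ((n : ℤ) + 1 - 1 < 0) := by omega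
    have h₃ : ((n : ℤ) + 1).toNat = n + 1 := by omega
    have h₄ : ((n : ℤ) + 1 - 1).toNat = n := by omega
    simp only [hz, if_neg h₁, if_neg h₂, h₃, h₄, hpow_succ_append_singleton]

theorem hz_nil_of_pos {R : Type*} [CommRing R] {m : ℤ} (hm : 0 < m) :
    hz m ([] : List R) = 0 := by
  obtain ⟨n, rfl⟩ : ∃ n : ℕ, m = n + 1 := ⟨(m - 1).toNat, by omega⟩
  have h₁ : ¬ ((n : ℤ) + 1 < 0) := by omega
  have h₂ : ((n : ℤ) + 1).toNat = n + 1 := by omega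
  simp only [hz, if_neg h₁, h₂, hpow]

theorem hz_map_range_succ {R : Type*} [CommRing R] (f : ℕ → R) (m : ℤ) (n : ℕ) :
    hz m ((List.range (n + 1)).map f) =
      hz m ((List.range n).map f) + f n * hz (m - 1) ((List.range (n + 1)).map f) := by
  rw [List.range_succ, List.map_append, List.map_singleton, hz_append_singleton]

theorem sum_hz_mul_hz_add {R : Type*} [CommRing R] (X : ℕ → R) (k : ℤ) (d i : ℕ)
    (hi : 1 ≤ i) :
    (∑ l ∈ Finset.Icc 1 (i + d),
        hz ((l : ℤ) - i) ((List.range (i + d + 1 - l)).map fun t => X (l + t)) *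
          hz (k - l + 1) ((List.range l).map fun t => X (1 + t))) =
      hz (k - i + 1) ((List.range (i + d)).map fun t => X (1 + t)) := by
  induction d generalizing i with
  | zero =>
    rw [Finset.sum_eq_single_of_mem i (by simp [hi])]
    · simp [hz, hpow]
    · intro l hl hli
      rw [Finset.mem_Icc] at hl
      rw [hz, if_pos (by omega), zero_mul]
  | succ d ih =>
    have hrec : ∀ l ∈ Finset.Icc 1 (i + d + 1),
        hz ((l : ℤ) - i) ((List.range (i + d + 1 + 1 - l)).map fun t => X (l + t)) *
            hz (k - l + 1) ((List.range l).map fun t => X (1 + t)) =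
          hz ((l : ℤ) - i) ((List.range (i + d + 1 - l)).map fun t => X (l + t)) *
              hz (k - l + 1) ((List.range l).map fun t => X (1 + t)) +
            X (i + d + 1) *
              (hz ((l : ℤ) - (i + 1 : ℕ))
                  ((List.range (i + 1 + d + 1 - l)).map fun t => X (l + t)) *
                hz (k - l + 1) ((List.range l).map fun t => X (1 + t))) := by
      intro l hl
      rw [Finset.mem_Icc] at hl
      rw [show i + d + 1 + 1 - l = i + d + 1 - l + 1 by omega,
        show i + 1 + d + 1 - l = i + d + 1 - l + 1 by omega, hz_map_range_succ,
        show l + (i + d + 1 - l) = i + d + 1 by omega,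
        show (l : ℤ) - i - 1 = (l : ℤ) - (i + 1 : ℕ) by push_cast; ring]
      ring
    have hlast : hz (((i + d + 1 : ℕ) : ℤ) - i)
        ((List.range (i + d + 1 - (i + d + 1))).map fun t => X (i + d + 1 + t)) = 0 := by
      rw [Nat.sub_self]
      exact hz_nil_of_pos (by omega)
    have hnext := ih (i + 1) (by omega)
    rw [show i + 1 + d = i + d + 1 by omega] at hnext hrec
    rw [← Nat.add_assoc, Finset.sum_congr rfl hrec, Finset.sum_add_distrib, ← Finset.mul_sum,
      hnext, Finset.sum_Icc_succ_top (by omega), hlast, zero_mul, add_zero, ih i hi,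
      hz_map_range_succ _ (k - i + 1) (i + d), show 1 + (i + d) = i + d + 1 by omega,
      show k - i + 1 - 1 = k - (i + 1 : ℕ) + 1 by push_cast; ring]

/-- For `N ≥ 1`, a commutative ring `R`, `X_1, …, X_N ∈ R`, `1 ≤ i ≤ N` and any integer `k`:
`Σ_{l=1}^{N} h_{l−i}(X_l, …, X_N) · h_{k−l+1}(X_1, …, X_l) = h_{k−i+1}(X_1, …, X_N)`. -/
theorem sum_h_mul_h_eq_h {R : Type*} [CommRing R] (N : ℕ) (hN : 1 ≤ N) (X : ℕ → R)
    (i : ℕ) (hi1 : 1 ≤ i) (hiN : i ≤ N) (k : ℤ) :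
    (∑ l ∈ Finset.Icc 1 N,
        hz ((l : ℤ) - i) ((List.range (N + 1 - l)).map fun t => X (l + t)) *
          hz (k - l + 1) ((List.range l).map fun t => X (1 + t))) =
      hz (k - i + 1) ((List.range N).map fun t => X (1 + t)) := by
  obtain ⟨d, rfl⟩ := Nat.exists_eq_add_of_le hiN
  exact sum_hz_mul_hz_add X k d i hi1

end
end

section
/- For every n ≥ 1, the following identity holds in the field F = ℚ(u, v, w, X_1, …, X_n): det_{1 ≤ i, j ≤ n} ( (u²X_i² + u w X_i)^j − (v²X_i^{−2} + v w X_i^{−1})^j ) = Σ_{σ ∈ S_n} sgn(σ) · ∏_{1 ≤ i ≤ j ≤ n} ( u X_{σ(j)} + v X_{σ(i)}^{−1} + w ) · ( u X_{σ(j)} − v X_{σ(i)}^{−1} ). -/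
noncomputable section

open Matrix Finset in
/-- Expansion of an alternating sum over `Perm (Fin (n + 1))` along the value at the last index. -/
theorem sum_perm_sign_mul_last {R : Type*} [CommRing R] (n : ℕ) (c : Fin (n + 1) → R)
    (g : (Fin n → Fin (n + 1)) → R) :
    ∑ σ : Equiv.Perm (Fin (n + 1)),
        ((Equiv.Perm.sign σ : ℤ) : R) * (g (fun i => σ i.castSucc) * c (σ (Fin.last n))) =
      ∑ k : Fin (n + 1), (-1) ^ ((k : ℕ) + n) * c k *
        ∑ τ : Equiv.Perm (Fin n),
          ((Equiv.Perm.sign τ : ℤ) : R) * g (fun i => k.succAbove (τ i)) := by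
  let e : Fin (n + 1) × Equiv.Perm (Fin n) → Equiv.Perm (Fin (n + 1)) := fun q =>
    q.1.cycleRange.symm * Equiv.Perm.decomposeFin.symm (0, q.2) * finRotate (n + 1)
  have e_last (q) : e q (Fin.last n) = q.1 := by
    simp [e]
  have e_castSucc (q) (i : Fin n) : e q i.castSucc = q.1.succAbove (q.2 i) := by
    simp [e]
  have e_sign (q) : ((Equiv.Perm.sign (e q) : ℤ) : R) =
      (-1) ^ ((q.1 : ℕ) + n) * ((Equiv.Perm.sign q.2 : ℤ) : R) := by
    simp [e, Equiv.Perm.decomposeFin.symm_sign, pow_add]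
    ring
  have e_bij : Function.Bijective e := by
    rw [Fintype.bijective_iff_injective_and_card]
    constructor
    · rintro ⟨k, τ⟩ ⟨k', τ'⟩ h
      have hk : k = k' := by simpa only [e_last] using DFunLike.congr_fun h (Fin.last n)
      subst hk
      congr 1
      ext1 i
      apply Fin.succAbove_right_injective (p := k)
      simpa only [e_castSucc] using DFunLike.congr_fun h i.castSucc
    · simp [Fintype.card_perm, Nat.factorial_succ]
  rw [← e_bij.sum_comp, Fintype.sum_prod_type]
  refine sum_congr rfl fun k _ => ?_
  rw [mul_sum]
  refine sum_congr rfl fun τ _ => ?_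
  simp only [e_sign, e_last, e_castSucc]
  ring

open Matrix Finset Polynomial in
theorem det_pow_sub_pow_eq_updateCol {R : Type*} [CommRing R] (n : ℕ) (y z : Fin (n + 1) → R) :
    (of fun i j : Fin (n + 1) => y i ^ ((j : ℕ) + 1) - z i ^ ((j : ℕ) + 1)).det =
      ((of fun i j : Fin (n + 1) => y i ^ ((j : ℕ) + 1) - z i ^ ((j : ℕ) + 1)).updateCol
        (Fin.last n) fun k => ∏ i, (y k - z i)).det := by
  nontriviality R
  let P : R[X] := ∏ i, (X - C (z i))
  have hP : P.Monic := monic_prod_of_monic _ _ fun i _ => monic_X_sub_C _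
  have hdeg : P.natDegree = n + 1 := by
    simp [P, natDegree_prod_of_monic _ _ fun i _ => monic_X_sub_C (z i)]
  have hlast : P.coeff (n + 1) = 1 := by rw [← hdeg]; exact hP
  have hcol : (fun k => ∏ i, (y k - z i)) = fun k => ∑ j : Fin (n + 1), P.coeff ((j : ℕ) + 1) •
      (of fun i j : Fin (n + 1) => y i ^ ((j : ℕ) + 1) - z i ^ ((j : ℕ) + 1)) k j := by
    funext k
    have hy : P.eval (y k) = ∏ i, (y k - z i) := by simp [P, eval_prod]
    have hz : P.eval (z k) = 0 := by
      simp only [P, eval_prod, eval_sub, eval_X, eval_C]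
      exact prod_eq_zero (mem_univ k) (sub_self _)
    rw [← hy, ← sub_zero (P.eval (y k)), ← hz, eval_eq_sum_range, eval_eq_sum_range, hdeg,
      ← sum_sub_distrib, sum_range_succ', sum_range]
    simp [mul_sub]
  rw [hcol, det_updateCol_sum]
  simp [hlast]

open Matrix Finset in
theorem det_pow_sub_pow_eq_antisymmetrizer {R : Type*} [CommRing R] (n : ℕ) (y z : Fin n → R) :
    (of fun i j : Fin n => y i ^ ((j : ℕ) + 1) - z i ^ ((j : ℕ) + 1)).det =
      ∑ σ : Equiv.Perm (Fin n), ((Equiv.Perm.sign σ : ℤ) : R) *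
        ∏ j, ∏ i, if i ≤ j then y (σ j) - z (σ i) else 1 := by
  induction n with
  | zero => simp
  | succ n ih =>
    have hsplit (σ : Equiv.Perm (Fin (n + 1))) :
        (∏ j, ∏ i, if i ≤ j then y (σ j) - z (σ i) else 1) =
          (∏ j : Fin n, ∏ i : Fin n,
            if i ≤ j then y (σ j.castSucc) - z (σ i.castSucc) else 1) *
          ∏ i, (y (σ (Fin.last n)) - z i) := by
      rw [Fin.prod_univ_castSucc]
      congr 1
      · refine prod_congr rfl fun j _ => ?_
        rw [Fin.prod_univ_castSucc]
        simp
      · simp only [Fin.le_last, if_true]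
        exact Equiv.prod_comp σ fun i => y (σ (Fin.last n)) - z i
    simp only [hsplit]
    rw [sum_perm_sign_mul_last n (fun k => ∏ i, (y k - z i))
      (fun f => ∏ j : Fin n, ∏ i : Fin n, if i ≤ j then y (f j) - z (f i) else 1),
      det_pow_sub_pow_eq_updateCol, det_succ_column _ (Fin.last n)]
    refine sum_congr rfl fun k _ => ?_
    rw [← ih (fun i => y (k.succAbove i)) (fun i => z (k.succAbove i))]
    simp only [updateCol_self, Fin.val_last]
    congr 2
    ext i j
    simp [Fin.castSucc_ne_last]

/-- **Antisymmetrizer formula for the VSASM generating function.** For `n ≥ 1`, in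
`ℚ(u,v,w,X_1,…,X_n)`:
`det_{1≤i,j≤n}((u²X_i² + uwX_i)^j − (v²X_i^{−2} + vwX_i^{−1})^j)
 = Σ_{σ ∈ S_n} sgn σ · ∏_{1≤i≤j≤n} (uX_{σ(j)} + vX_{σ(i)}^{−1} + w)(uX_{σ(j)} − vX_{σ(i)}^{−1})`. -/
theorem det_bialternant_eq_antisymmetrizer (n : ℕ) (hn : 1 ≤ n) :
    (Matrix.of fun i j : Fin n =>
        ((uu n) ^ 2 * (XP i) ^ 2 + uu n * wP n * XP i) ^ ((j : ℕ) + 1) -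
          ((vv n) ^ 2 * ((XP i)⁻¹) ^ 2 + vv n * wP n * (XP i)⁻¹) ^ ((j : ℕ) + 1)).det =
      ∑ σ : Equiv.Perm (Fin n),
        ((Equiv.Perm.sign σ : ℤ) : Fld n) *
          ∏ p ∈ Finset.univ.filter (fun p : Fin n × Fin n => p.1 ≤ p.2),
            ((uu n * XP (σ p.2) + vv n * (XP (σ p.1))⁻¹ + wP n) *
              (uu n * XP (σ p.2) - vv n * (XP (σ p.1))⁻¹)) := by
  rw [det_pow_sub_pow_eq_antisymmetrizer n
    (fun i => (uu n) ^ 2 * (XP i) ^ 2 + uu n * wP n * XP i)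
    (fun i => (vv n) ^ 2 * ((XP i)⁻¹) ^ 2 + vv n * wP n * (XP i)⁻¹)]
  refine Finset.sum_congr rfl fun σ _ => ?_
  rw [Finset.prod_filter, Fintype.prod_prod_type_right]
  congr 1
  refine Finset.prod_congr rfl fun j _ => Finset.prod_congr rfl fun i _ => ?_
  split_ifs
  · ring
  · rfl

end
end
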